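/- arXiv:2109.08666 — 2 statements merged into one kernel-verified Lean document; each statement's English description precedes it below -/
import Mathlib

section
/- Let n ≥ 1, J := (1/n)𝟏𝟏ᵀ ∈ ℝ^{n×n}, σ > 0, and let W ∈ ℝ^{n×n} be real symmetric positive semidefinite. Let W + J = Q diag(μ₁, …, μ_n) Qᵀ be a spectral decomposition with Q orthogonal. Then the function Y ↦ -σ^{-1} log det(Y + J) + (1/2)‖W - Y‖_F², restricted to real symmetric matrices Y such that Y + J is positive definite, has a unique minimizer, equal to Q diag( (μ₁ + √(μ₁² + 4σ^{-1}))/2, …, (μ_n + √(μ_n² + 4σ^{-1}))/2 ) Qᵀ - J. -/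
open Matrix

lemma aux_logdet {n : ℕ} {P : Matrix (Fin n) (Fin n) ℝ} (hP : P.PosDef) :
    Real.log P.det ≤ ∑ i, (P i i - 1) := by
  have h1 : P.det = ∏ i, hP.1.eigenvalues i := by
    simpa using hP.1.det_eq_prod_eigenvalues
  have h2 : P.trace = ∑ i, hP.1.eigenvalues i := by
    simpa using hP.1.trace_eq_sum_eigenvalues
  have h3 : ∑ i, (P i i - 1) = ∑ i, (hP.1.eigenvalues i - 1) := by
    rw [Finset.sum_sub_distrib, Finset.sum_sub_distrib, ← h2]; rfl
  rw [h3, h1, Real.log_prod (fun i _ => (hP.eigenvalues_pos i).ne')]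
  exact Finset.sum_le_sum fun i _ => Real.log_le_sub_one_of_pos (hP.eigenvalues_pos i)

lemma aux_logdet' {n : ℕ} {Z : Matrix (Fin n) (Fin n) ℝ} (hZ : Z.PosDef) (d : Fin n → ℝ)
    (hd : ∀ i, 0 < d i) :
    Real.log Z.det ≤ Real.log (∏ i, d i) + ∑ i, (Z i i / d i - 1) := by
  set E : Matrix (Fin n) (Fin n) ℝ := Matrix.diagonal (fun i => (Real.sqrt (d i))⁻¹) with hE
  have hs : ∀ i, 0 < Real.sqrt (d i) := fun i => Real.sqrt_pos.2 (hd i)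
  have hEd : E.det = ∏ i, (Real.sqrt (d i))⁻¹ := by rw [hE, Matrix.det_diagonal]
  have hEu : IsUnit E := by
    rw [Matrix.isUnit_iff_isUnit_det, hEd, isUnit_iff_ne_zero]
    exact Finset.prod_ne_zero_iff.2 fun i _ => (inv_pos.2 (hs i)).ne'
  have hP : (Eᴴ * Z * E).PosDef :=
    hZ.conjTranspose_mul_mul_same (Matrix.mulVec_injective_iff_isUnit.2 hEu)
  have hEH : Eᴴ = E := by
    rw [hE, Matrix.diagonal_conjTranspose]; congr 1
  rw [hEH] at hP
  have h := aux_logdet hP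
  have hpd : 0 < ∏ i, d i := Finset.prod_pos fun i _ => hd i
  have hdet : (E * Z * E).det = (∏ i, d i)⁻¹ * Z.det := by
    rw [Matrix.det_mul, Matrix.det_mul, mul_right_comm, hEd, ← Finset.prod_mul_distrib,
      ← Finset.prod_inv_distrib]
    congr 1
    refine Finset.prod_congr rfl fun i _ => ?_
    rw [← mul_inv, Real.mul_self_sqrt (hd i).le]
  have hdiag : ∀ i, (E * Z * E) i i = Z i i / d i := by
    intro i
    rw [hE, Matrix.mul_diagonal, Matrix.diagonal_mul, mul_right_comm, ← mul_inv,
      Real.mul_self_sqrt (hd i).le]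
    ring
  rw [hdet, Real.log_mul (inv_pos.2 hpd).ne' hZ.det_pos.ne', Real.log_inv] at h
  simp only [hdiag] at h
  linarith

lemma aux_frob {n : ℕ} (A : Matrix (Fin n) (Fin n) ℝ) :
    ∑ p, ∑ q, A p q ^ 2 = (A * Aᵀ).trace := by
  simp [Matrix.trace, Matrix.mul_apply, sq]

lemma aux_conj {n : ℕ} (A Q : Matrix (Fin n) (Fin n) ℝ) (hQ : Q * Qᵀ = 1) :
    ∑ p, ∑ q, (Qᵀ * A * Q) p q ^ 2 = ∑ p, ∑ q, A p q ^ 2 := by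
  rw [aux_frob, aux_frob]
  have : Qᵀ * A * Q * (Qᵀ * A * Q)ᵀ = Qᵀ * (A * (Q * Qᵀ) * Aᵀ * Q) := by
    simp only [Matrix.transpose_mul, Matrix.transpose_transpose, Matrix.mul_assoc]
  rw [this, Matrix.trace_mul_comm, hQ, Matrix.mul_one, Matrix.mul_assoc, hQ, Matrix.mul_one]

/-- The diagonal case. -/
lemma aux_main {n : ℕ} (s : ℝ) (hs : 0 < s) (μ d : Fin n → ℝ) (hd : ∀ i, 0 < d i)
    (hmu : ∀ i, d i * d i = μ i * d i + s) (Z : Matrix (Fin n) (Fin n) ℝ) (hZ : Z.PosDef)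
    (hne : Z ≠ Matrix.diagonal d) :
    -s * Real.log (∏ i, d i)
        + (1 / 2) * ∑ p, ∑ q, (Matrix.diagonal μ - Matrix.diagonal d) p q ^ 2
      < -s * Real.log Z.det + (1 / 2) * ∑ p, ∑ q, (Matrix.diagonal μ - Z) p q ^ 2 := by
  have h1 := mul_le_mul_of_nonneg_left (aux_logdet' hZ d hd) hs.le
  have h2 : 0 < ∑ p, ∑ q, (Z - Matrix.diagonal d) p q ^ 2 := by
    have h0 : ∀ p, 0 ≤ ∑ q, (Z - Matrix.diagonal d) p q ^ 2 :=
      fun p => Finset.sum_nonneg fun q _ => sq_nonneg _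
    refine lt_of_le_of_ne (Finset.sum_nonneg fun p _ => h0 p) fun h => hne ?_
    ext p q
    have h3 := (Finset.sum_eq_zero_iff_of_nonneg (fun p _ => h0 p)).1 h.symm p (Finset.mem_univ _)
    have h4 := (Finset.sum_eq_zero_iff_of_nonneg (fun q _ => sq_nonneg _)).1 h3 q
      (Finset.mem_univ _)
    have h5 := pow_eq_zero_iff (two_ne_zero) |>.1 h4
    rw [Matrix.sub_apply] at h5
    linarith
  have h3 : ∑ p, ∑ q, (Matrix.diagonal μ - Z) p q ^ 2
      = ∑ p, ∑ q, (Matrix.diagonal μ - Matrix.diagonal d) p q ^ 2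
        + ∑ p, ∑ q, (Z - Matrix.diagonal d) p q ^ 2
        + 2 * (s * ∑ i, (Z i i / d i - 1)) := by
    have h4 : s * ∑ i, (Z i i / d i - 1)
        = ∑ p, ∑ q, if p = q then s * (Z p q / d p - 1) else 0 := by
      rw [Finset.mul_sum]; simp
    rw [h4, Finset.mul_sum]
    simp only [Finset.mul_sum, ← Finset.sum_add_distrib]
    refine Finset.sum_congr rfl fun p _ => Finset.sum_congr rfl fun q _ => ?_
    by_cases hpq : p = q
    · subst hpq
      have hp := (hd p).ne'
      simp only [Matrix.sub_apply, Matrix.diagonal_apply_eq, if_true]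
      have : s = (d p - μ p) * d p := by linarith [hmu p]
      rw [this]
      field_simp
      ring
    · simp [Matrix.sub_apply, Matrix.diagonal_apply_ne _ hpq, hpq]
  rw [h3]
  linarith

/-- Let `J := (1/n)𝟏𝟏ᵀ`, `σ > 0`, `W` real symmetric positive semidefinite, and let
`W + J = Q diag(μ) Qᵀ` be a spectral decomposition (`Q` orthogonal). Then
`Y ↦ -σ⁻¹ log det(Y + J) + (1/2)‖W - Y‖_F²`, restricted to symmetric `Y` with `Y + J`
positive definite, has the unique minimizer
`Q diag((μᵢ + √(μᵢ² + 4σ⁻¹))/2) Qᵀ - J`. -/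
theorem prox_neg_logdet_shifted {n : ℕ} (hn : 1 ≤ n) (σ : ℝ) (hσ : 0 < σ)
    (W Q : Matrix (Fin n) (Fin n) ℝ) (μ : Fin n → ℝ)
    (hW : W.PosSemidef) (hQ : Qᵀ * Q = 1)
    (hdec : W + Matrix.of (fun _ _ => (1 : ℝ) / n) = Q * Matrix.diagonal μ * Qᵀ) :
    let J : Matrix (Fin n) (Fin n) ℝ := Matrix.of fun _ _ => (1 : ℝ) / n
    let Ystar := Q * Matrix.diagonal
        (fun i => (μ i + Real.sqrt ((μ i) ^ 2 + 4 * σ⁻¹)) / 2) * Qᵀ - J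
    Ystar.IsSymm ∧ (Ystar + J).PosDef ∧
    (∀ Y : Matrix (Fin n) (Fin n) ℝ, Y.IsSymm → (Y + J).PosDef → Y ≠ Ystar →
      -σ⁻¹ * Real.log (Ystar + J).det
          + (1 / 2) * ∑ p : Fin n, ∑ q : Fin n, (W p q - Ystar p q) ^ 2
        < -σ⁻¹ * Real.log (Y + J).det
          + (1 / 2) * ∑ p : Fin n, ∑ q : Fin n, (W p q - Y p q) ^ 2) := by
  intro J Ystar
  set d : Fin n → ℝ := fun i => (μ i + Real.sqrt ((μ i) ^ 2 + 4 * σ⁻¹)) / 2 with hdd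
  have hs : 0 < σ⁻¹ := inv_pos.2 hσ
  have hd : ∀ i, 0 < d i := by
    intro i
    have : |μ i| < Real.sqrt ((μ i) ^ 2 + 4 * σ⁻¹) := by
      rw [← Real.sqrt_sq_eq_abs]
      exact Real.sqrt_lt_sqrt (sq_nonneg _) (by linarith)
    have := neg_abs_le (μ i)
    simp only [hdd]
    linarith
  have hmu : ∀ i, d i * d i = μ i * d i + σ⁻¹ := by
    intro i
    have := Real.mul_self_sqrt (show 0 ≤ (μ i) ^ 2 + 4 * σ⁻¹ by positivity)
    simp only [hdd]
    nlinarith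
  have hQ' : Q * Qᵀ = 1 := mul_eq_one_comm.1 hQ
  have hYJ : Ystar + J = Q * Matrix.diagonal d * Qᵀ := sub_add_cancel _ _
  have hJ : J.IsSymm := by ext; rfl
  have hQu : IsUnit Q := IsUnit.of_mul_eq_one _ hQ'
  have hQtu : IsUnit Qᵀ := IsUnit.of_mul_eq_one _ hQ
  have hback : ∀ A : Matrix (Fin n) (Fin n) ℝ, Qᵀ * (Q * A * Qᵀ) * Q = A := by
    intro A
    have : Qᵀ * (Q * A * Qᵀ) * Q = (Qᵀ * Q) * A * (Qᵀ * Q) := by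
      simp only [Matrix.mul_assoc]
    rw [this, hQ, Matrix.one_mul, Matrix.mul_one]
  have hforth : ∀ A : Matrix (Fin n) (Fin n) ℝ, Q * (Qᵀ * A * Q) * Qᵀ = A := by
    intro A
    have : Q * (Qᵀ * A * Q) * Qᵀ = (Q * Qᵀ) * A * (Q * Qᵀ) := by
      simp only [Matrix.mul_assoc]
    rw [this, hQ', Matrix.one_mul, Matrix.mul_one]
  have hdet : ∀ A : Matrix (Fin n) (Fin n) ℝ, (Q * A * Qᵀ).det = A.det := by
    intro A
    rw [Matrix.det_mul, Matrix.det_mul, mul_right_comm, ← Matrix.det_mul, hQ', Matrix.det_one,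
      one_mul]
  refine ⟨?_, ?_, ?_⟩
  · refine Matrix.IsSymm.sub ?_ hJ
    simp [Matrix.IsSymm, Matrix.transpose_mul, Matrix.mul_assoc]
  · rw [hYJ]
    have := (Matrix.PosDef.diagonal hd).conjTranspose_mul_mul_same
      (B := Qᵀ) (Matrix.mulVec_injective_iff_isUnit.2 hQtu)
    simpa [Matrix.conjTranspose_eq_transpose_of_trivial] using this
  · intro Y _ hY hne
    have hZ : (Qᵀ * (Y + J) * Q).PosDef := by
      have := hY.conjTranspose_mul_mul_same
        (B := Q) (Matrix.mulVec_injective_iff_isUnit.2 hQu)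
      simpa [Matrix.conjTranspose_eq_transpose_of_trivial] using this
    have hZne : Qᵀ * (Y + J) * Q ≠ Matrix.diagonal d := by
      intro h
      apply hne
      have h1 := hforth (Y + J)
      rw [h, ← hYJ] at h1
      exact (add_right_cancel h1).symm
    have key := aux_main σ⁻¹ hs μ d hd hmu _ hZ hZne
    have hWJ : Qᵀ * (W + J) * Q = Matrix.diagonal μ := by
      rw [show W + J = Q * Matrix.diagonal μ * Qᵀ from hdec, hback]
    have hfr : ∀ V : Matrix (Fin n) (Fin n) ℝ,
        ∑ p, ∑ q, (Matrix.diagonal μ - Qᵀ * (V + J) * Q) p q ^ 2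
          = ∑ p, ∑ q, (W p q - V p q) ^ 2 := by
      intro V
      rw [← hWJ, ← Matrix.sub_mul, ← Matrix.mul_sub, add_sub_add_right_eq_sub,
        aux_conj _ _ hQ']
      rfl
    have h1 := hfr Ystar
    rw [hYJ, hback] at h1
    have h2 : (Qᵀ * (Y + J) * Q).det = (Y + J).det := by
      rw [← hdet, hforth]
    rw [h1, hfr Y, h2] at key
    rw [hYJ, hdet, Matrix.det_diagonal]
    exact key
end

section
/- Let n ≥ 2 and let L be the combinatorial-graph-Laplacian operator. For the all-ones weight vector 𝟏 ∈ ℝ^{n(n-1)/2}, one has ‖L(𝟏)‖_F² = 2n ‖𝟏‖₂², i.e., the bound ‖L(w)‖_F² ≤ 2n‖w‖₂² is attained; consequently the operator norm of L satisfies ‖L‖² := sup_{w ≠ 0} ‖L(w)‖_F² / ‖w‖₂² = 2n. -/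
/-- Entry of the weight function associated to an upper-triangular weight vector. -/
def wEnt {n : ℕ} (w : {pq : Fin n × Fin n // pq.1 < pq.2} → ℝ) (p q : Fin n) : ℝ :=
  if h : p < q then w ⟨(p, q), h⟩ else if h' : q < p then w ⟨(q, p), h'⟩ else 0

/-- The combinatorial-graph-Laplacian operator. -/
def Lap {n : ℕ} (w : {pq : Fin n × Fin n // pq.1 < pq.2} → ℝ) :
    Matrix (Fin n) (Fin n) ℝ :=
  Matrix.of fun p q => if p = q then ∑ r : Fin n, wEnt w p r else - wEnt w p q

theorem wEnt_self' {n : ℕ} (w : {pq : Fin n × Fin n // pq.1 < pq.2} → ℝ) (p : Fin n) :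
    wEnt w p p = 0 := by simp [wEnt]

theorem lap_row {n : ℕ} (w : {pq : Fin n × Fin n // pq.1 < pq.2} → ℝ) (p : Fin n) :
    ∑ q : Fin n, (Lap w p q) ^ 2 = (∑ r, wEnt w p r) ^ 2 + ∑ q, (wEnt w p q) ^ 2 := by
  have h : ∀ q, (Lap w p q) ^ 2 =
      (if p = q then (∑ r, wEnt w p r) ^ 2 else 0) + (wEnt w p q) ^ 2 := by
    intro q
    by_cases hpq : p = q
    · subst hpq
      simp [Lap, wEnt_self']
    · simp [Lap, hpq]
  rw [Finset.sum_congr rfl (fun q _ => h q), Finset.sum_add_distrib]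
  simp

theorem wEnt_sum {n : ℕ} (w : {pq : Fin n × Fin n // pq.1 < pq.2} → ℝ) :
    ∑ p : Fin n, ∑ q : Fin n, (wEnt w p q) ^ 2 = 2 * ∑ i, (w i) ^ 2 := by
  have h : ∀ p q : Fin n, (wEnt w p q) ^ 2 =
      (if p < q then (wEnt w p q) ^ 2 else 0) + (if q < p then (wEnt w q p) ^ 2 else 0) := by
    intro p q
    rcases lt_trichotomy p q with h | h | h
    · simp [h, h.not_gt]
    · subst h
      simp [wEnt_self']
    · simp [wEnt, h, h.not_gt]
  have hS : ∑ p : Fin n, ∑ q : Fin n, (if p < q then (wEnt w p q) ^ 2 else 0)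
      = ∑ i, (w i) ^ 2 := by
    rw [← Fintype.sum_prod_type' (fun p q : Fin n => if p < q then (wEnt w p q) ^ 2 else 0),
      ← Finset.sum_filter,
      Finset.sum_subtype (p := fun pq : Fin n × Fin n => pq.1 < pq.2) _ (by simp)]
    refine Finset.sum_congr rfl fun i _ => ?_
    obtain ⟨⟨p, q⟩, hi⟩ := i
    have hi' : p < q := hi
    simp [wEnt, hi']
  rw [Finset.sum_congr rfl (fun p _ => Finset.sum_congr rfl (fun q _ => h p q))]
  simp only [Finset.sum_add_distrib]
  rw [hS, Finset.sum_comm, hS]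
  ring

theorem row_le {n : ℕ} (w : {pq : Fin n × Fin n // pq.1 < pq.2} → ℝ) (p : Fin n) :
    (∑ r, wEnt w p r) ^ 2 ≤ ((n : ℝ) - 1) * ∑ q, (wEnt w p q) ^ 2 := by
  have h1 : ∑ r, wEnt w p r = ∑ r ∈ Finset.univ.erase p, wEnt w p r :=
    (Finset.sum_erase _ (wEnt_self' w p)).symm
  have h2 : ∑ r, (wEnt w p r) ^ 2 = ∑ r ∈ Finset.univ.erase p, (wEnt w p r) ^ 2 :=
    (Finset.sum_erase _ (by simp [wEnt_self'])).symm
  have hc : (((Finset.univ.erase p).card : ℕ) : ℝ) = (n : ℝ) - 1 := by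
    rw [Finset.card_erase_of_mem (Finset.mem_univ p), Finset.card_univ, Fintype.card_fin,
      Nat.cast_sub p.pos]
    simp
  rw [h1, h2, ← hc]
  exact sq_sum_le_card_mul_sum_sq

theorem lap_le {n : ℕ} (w : {pq : Fin n × Fin n // pq.1 < pq.2} → ℝ) :
    ∑ p : Fin n, ∑ q : Fin n, (Lap w p q) ^ 2 ≤ 2 * n * ∑ i, (w i) ^ 2 := by
  calc _ ≤ ∑ p : Fin n, (n : ℝ) * ∑ q, (wEnt w p q) ^ 2 := by
        refine Finset.sum_le_sum fun p _ => ?_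
        rw [lap_row]
        linarith [row_le w p]
    _ = _ := by
        rw [← Finset.mul_sum, wEnt_sum]
        ring

theorem lap_one {n : ℕ} :
    ∑ p : Fin n, ∑ q : Fin n, (Lap (fun _ => (1 : ℝ)) p q) ^ 2
      = 2 * n * ∑ _i : {pq : Fin n × Fin n // pq.1 < pq.2}, (1 : ℝ) ^ 2 := by
  have h : ∀ p q : Fin n, wEnt (fun _ => (1 : ℝ)) p q = 1 - if p = q then 1 else 0 := by
    intro p q
    rcases lt_trichotomy p q with h | h | h
    · simp [wEnt, h, h.ne]
    · simp [wEnt, h]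
    · simp [wEnt, h, h.ne']
  have hs : ∀ p : Fin n, ∑ q, wEnt (fun _ => (1 : ℝ)) p q = n - 1 := by
    intro p
    simp [h]
  have h2 : ∀ p : Fin n, ∑ q, (wEnt (fun _ => (1 : ℝ)) p q) ^ 2 = n - 1 := by
    intro p
    rw [← hs p]
    refine Finset.sum_congr rfl fun q _ => ?_
    rw [h]
    split_ifs <;> norm_num
  have := wEnt_sum (n := n) (fun _ => (1 : ℝ))
  rw [mul_comm (2 : ℝ), mul_assoc, ← this, Finset.mul_sum]
  refine Finset.sum_congr rfl fun p _ => ?_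
  rw [lap_row, hs, h2]
  ring

/-- The bound `‖L(w)‖_F² ≤ 2n‖w‖₂²` is attained at the all-ones weight vector, and
consequently the squared operator norm `sup_{w ≠ 0} ‖L(w)‖_F²/‖w‖₂²` equals `2n`. -/
theorem cgl_operator_norm {n : ℕ} (hn : 2 ≤ n) :
    (∑ p : Fin n, ∑ q : Fin n, (Lap (fun _ => (1 : ℝ)) p q) ^ 2
      = 2 * n * ∑ _i : {pq : Fin n × Fin n // pq.1 < pq.2}, (1 : ℝ) ^ 2) ∧
    IsGreatest
      {r : ℝ | ∃ w : {pq : Fin n × Fin n // pq.1 < pq.2} → ℝ, w ≠ 0 ∧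
        r = (∑ p : Fin n, ∑ q : Fin n, (Lap w p q) ^ 2)
              / (∑ i : {pq : Fin n × Fin n // pq.1 < pq.2}, (w i) ^ 2)}
      (2 * n) := by
  refine ⟨lap_one, ⟨fun _ => 1, ?_, ?_⟩, ?_⟩
  · intro h0
    have := congrFun h0 ⟨(⟨0, by omega⟩, ⟨1, by omega⟩), by simp⟩
    simp at this
  · rw [lap_one]
    have hpos : 0 < ∑ _i : {pq : Fin n × Fin n // pq.1 < pq.2}, (1 : ℝ) ^ 2 :=
      Finset.sum_pos (fun _ _ => by norm_num)
        ⟨⟨(⟨0, by omega⟩, ⟨1, by omega⟩), by simp⟩, Finset.mem_univ _⟩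
    rw [mul_div_assoc, div_self hpos.ne', mul_one]
  · rintro r ⟨w, -, rfl⟩
    exact div_le_of_le_mul₀ (Finset.sum_nonneg fun i _ => sq_nonneg _) (by positivity) (lap_le w)
end
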